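/- Let m ≥ 1 be a natural number and let A be a real (2m)×(2m) matrix which is orthogonal (Aᵀ·A = 1) and has determinant 1. Then there exists a continuous path γ : [0,1] → Matrix (Fin (2m)) (Fin (2m)) ℝ with γ(0) = 1 and γ(1) = −1 such that for every t ∈ [0,1] the matrix γ(t) is orthogonal, has determinant 1, and commutes with A (A·γ(t) = γ(t)·A). In other words, −Id lies in the identity component of the centralizer of A in SO(2m, ℝ). -/

import Mathlib

open Matrix

section SkewCentralizer

variable {n : Type*} [Fintype n]

lemma mulVec_eq_zero_of_transpose_mul {K : Matrix n n ℝ} {x : n → ℝ}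
    (h : (Kᵀ * K) *ᵥ x = 0) : K *ᵥ x = 0 := by
  rw [← dotProduct_self_eq_zero, Matrix.dotProduct_mulVec, ← Matrix.mulVec_transpose,
    Matrix.mulVec_mulVec, h, zero_dotProduct]

variable [DecidableEq n]

/-- An orthonormal basis of the kernel of a real matrix, arranged as the columns of a matrix. -/
lemma exists_orthonormal_columns_ker (M : Matrix n n ℝ) :
    ∃ (k : ℕ) (B : Matrix n (Fin k) ℝ), Bᵀ * B = 1 ∧ M * B = 0 ∧
      ∀ x, M *ᵥ x = 0 → B *ᵥ (Bᵀ *ᵥ x) = x := by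
  have b := stdOrthonormalBasis ℝ (LinearMap.ker (Matrix.toEuclideanLin M))
  refine ⟨_, Matrix.of fun i j => (b j : EuclideanSpace ℝ n) i, ?_, ?_, ?_⟩
  · ext i j
    have h := orthonormal_iff_ite.mp b.orthonormal i j
    rw [Submodule.coe_inner, PiLp.inner_apply] at h
    rw [Matrix.one_apply, ← h, Matrix.mul_apply]
    exact Finset.sum_congr rfl fun _ _ => mul_comm _ _
  · ext i j
    have h : Matrix.toEuclideanLin M (b j : EuclideanSpace ℝ n) = 0 := (b j).2
    exact congrArg (fun v : EuclideanSpace ℝ n => v i) h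
  · intro x hx
    have hxV : WithLp.toLp 2 x ∈ LinearMap.ker (Matrix.toEuclideanLin M) := by
      simp [Matrix.toLpLin_apply, hx]
    have h := congrArg Subtype.val (b.sum_repr' ⟨_, hxV⟩)
    ext i
    have h' := congrArg (fun v : EuclideanSpace ℝ n => v i) h
    simp only [Submodule.coe_sum, Submodule.coe_smul, Submodule.coe_inner, PiLp.inner_apply,
      WithLp.ofLp_sum, Finset.sum_apply, WithLp.ofLp_smul, Pi.smul_apply, smul_eq_mul] at h'
    refine Eq.trans ?_ h'
    rw [Matrix.mulVec, dotProduct]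
    refine Finset.sum_congr rfl fun j _ => ?_
    rw [mul_comm]
    refine congrArg (· * _) ?_
    rw [Matrix.mulVec, dotProduct]
    exact Finset.sum_congr rfl fun _ _ => mul_comm _ _

lemma eq_zero_of_neg_eq_self {m : Type*} {M : Matrix m m ℝ} (h : -M = M) : M = 0 := by
  ext i j
  exact self_eq_neg.mp (congrFun (congrFun h i) j).symm

lemma det_ne_zero_of_mulVec_eq_zero {M : Matrix n n ℝ} (h : ∀ x, M *ᵥ x = 0 → x = 0) :
    M.det ≠ 0 := by
  intro h0
  obtain ⟨v, hv, hMv⟩ := Matrix.exists_mulVec_eq_zero_iff.mpr h0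
  exact hv (h v hMv)

lemma transpose_mul_eq_neg {k : Type*} {A : Matrix n n ℝ}
    {B : Matrix n k ℝ} (hA : Aᵀ * A = 1) (hAB : A * B = -B) : Bᵀ * A = -Bᵀ := by
  have h : Aᵀ * B = -B := by
    have : Aᵀ * (A * B) = B := by rw [← Matrix.mul_assoc, hA, Matrix.one_mul]
    rw [hAB, Matrix.mul_neg] at this
    rw [← this, neg_neg, this]
  simpa using congrArg Matrix.transpose h

/-- The `-1`-eigenspace of a special orthogonal matrix is even-dimensional. -/
lemma even_of_columns_ker_add_one {A : Matrix n n ℝ} (hA : Aᵀ * A = 1) (hdet : A.det = 1)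
    {k : ℕ} {B : Matrix n (Fin k) ℝ} (hB : Bᵀ * B = 1) (hAB : A * B = -B)
    (hker : ∀ x, (A + 1) *ᵥ x = 0 → B *ᵥ (Bᵀ *ᵥ x) = x) : Even k := by
  have hBA := transpose_mul_eq_neg hA hAB
  set R : Matrix n n ℝ := 1 + B * ((-2 : ℝ) • Bᵀ) with hR
  have hRR : Rᵀ * R = 1 := by
    have hBB : B * Bᵀ * (B * Bᵀ) = B * Bᵀ := by
      rw [Matrix.mul_assoc, ← Matrix.mul_assoc Bᵀ, hB, Matrix.one_mul]
    have : Rᵀ = R := by simp [hR]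
    rw [this, hR, Matrix.mul_smul]
    simp only [mul_add, add_mul, one_mul, mul_one, smul_mul_smul_comm, hBB]
    module
  have hRdet : R.det = (-1) ^ k := by
    rw [hR, Matrix.det_one_add_mul_comm, Matrix.smul_mul, hB]
    have : (1 : Matrix (Fin k) (Fin k) ℝ) + (-2 : ℝ) • 1 = -1 := by module
    rw [this, Matrix.det_neg]
    simp
  have hC : (A * R)ᵀ * (A * R) = 1 := by
    rw [Matrix.transpose_mul, Matrix.mul_assoc, ← Matrix.mul_assoc Aᵀ, hA, Matrix.one_mul, hRR]
  have hCe : A * R = A + (2 : ℝ) • (B * Bᵀ) := by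
    rw [hR, mul_add, mul_one, ← Matrix.mul_assoc, hAB, Matrix.mul_smul, Matrix.neg_mul]
    module
  have hne : (1 + A * R).det ≠ 0 := by
    refine det_ne_zero_of_mulVec_eq_zero fun x hx => ?_
    have h1 : Bᵀ * (1 + A * R) = (2 : ℝ) • Bᵀ := by
      rw [hCe, Matrix.mul_add, Matrix.mul_add, hBA, Matrix.mul_smul, ← Matrix.mul_assoc, hB, Matrix.one_mul,
        Matrix.mul_one]
      module
    have h2 : Bᵀ *ᵥ x = 0 := by
      have : (Bᵀ * (1 + A * R)) *ᵥ x = 0 := by rw [← Matrix.mulVec_mulVec, hx, Matrix.mulVec_zero]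
      rw [h1, Matrix.smul_mulVec] at this
      exact (smul_eq_zero.mp this).resolve_left two_ne_zero
    have h3 : (A + 1) *ᵥ x = 0 := by
      rw [hCe, ← add_assoc, Matrix.add_mulVec, Matrix.smul_mulVec, ← Matrix.mulVec_mulVec, h2,
        Matrix.mulVec_zero, smul_zero, add_zero, add_comm] at hx
      exact hx
    rw [← hker x h3, h2, Matrix.mulVec_zero]
  have hfac : 1 + A * R = (A * R) * (1 + A * R)ᵀ := by
    rw [Matrix.transpose_add, Matrix.transpose_one, mul_add (A * R), mul_one, mul_eq_one_comm.mp hC,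
      add_comm]
  have hdet1 : (A * R).det = 1 := by
    have h := congrArg Matrix.det hfac
    rw [Matrix.det_mul, Matrix.det_transpose] at h
    exact mul_right_cancel₀ hne (by rw [← h, one_mul])
  rw [Matrix.det_mul, hdet, one_mul, hRdet] at hdet1
  exact (neg_one_pow_eq_one_iff_even (by norm_num)).mp hdet1

/-- A skew-symmetric matrix supported and nondegenerate on the `-1`-eigenspace of a special
orthogonal matrix. -/
lemma exists_skew_on_neg_one_eigenspace {A : Matrix n n ℝ} (hA : Aᵀ * A = 1)
    (hdet : A.det = 1) :
    ∃ K : Matrix n n ℝ, Kᵀ = -K ∧ A * K = -K ∧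
      ∀ x, A *ᵥ x = -x → K *ᵥ x = 0 → x = 0 := by
  obtain ⟨k, B, hB, hMB, hker⟩ := exists_orthonormal_columns_ker (A + 1)
  have hAB : A * B = -B := by
    rw [Matrix.add_mul, Matrix.one_mul] at hMB
    exact eq_neg_of_add_eq_zero_left hMB
  obtain ⟨l, rfl⟩ := even_of_columns_ker_add_one hA hdet hB hAB hker
  let J : Matrix (Fin (l + l)) (Fin (l + l)) ℝ :=
    (Matrix.J (Fin l) ℝ).submatrix finSumFinEquiv.symm finSumFinEquiv.symm
  have hJt : Jᵀ = -J := by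
    simp only [J, Matrix.transpose_submatrix, Matrix.J_transpose]
    rfl
  have hJJ : J * J = -1 := by
    simp only [J, Matrix.submatrix_mul_equiv, Matrix.J_squared]
    ext i j
    simp [Matrix.one_apply]
  refine ⟨B * J * Bᵀ, ?_, ?_, fun x hx hKx => ?_⟩
  · simp [Matrix.transpose_mul, hJt, Matrix.mul_assoc]
  · rw [← Matrix.mul_assoc, ← Matrix.mul_assoc, hAB, Matrix.neg_mul, Matrix.neg_mul]
  · have h : (J * Bᵀ * (B * J * Bᵀ)) *ᵥ x = 0 := by
      rw [← Matrix.mulVec_mulVec, hKx, Matrix.mulVec_zero]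
    have h' : J * Bᵀ * (B * J * Bᵀ) = -Bᵀ := by
      calc J * Bᵀ * (B * J * Bᵀ) = J * (Bᵀ * B) * J * Bᵀ := by simp only [Matrix.mul_assoc]
        _ = -Bᵀ := by rw [hB, Matrix.mul_one, hJJ, Matrix.neg_mul, Matrix.one_mul]
    rw [h', Matrix.neg_mulVec, neg_eq_zero] at h
    rw [← hker x (by rw [Matrix.add_mulVec, hx, Matrix.one_mulVec, neg_add_cancel]), h,
      Matrix.mulVec_zero]

/-- A special orthogonal matrix of even size commutes with an invertible skew-symmetric matrix. -/
lemma exists_invertible_skew_commute {A : Matrix n n ℝ} (hn : Even (Fintype.card n))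
    (hA : Aᵀ * A = 1) (hdet : A.det = 1) :
    ∃ S : Matrix n n ℝ, Sᵀ = -S ∧ A * S = S * A ∧ ∀ x, S *ᵥ x = 0 → x = 0 := by
  obtain ⟨K, hKt, hAK, hK⟩ := exists_skew_on_neg_one_eigenspace hA hdet
  obtain ⟨L, hLt, hAL, hL⟩ := exists_skew_on_neg_one_eigenspace (A := -A) (by simpa using hA)
    (by rw [Matrix.det_neg, hn.neg_one_pow, hdet, one_mul])
  have hKA : K * A = -K := by
    simpa [hKt, neg_eq_iff_eq_neg] using transpose_mul_eq_neg hA hAK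
  have hLA : L * A = L := by
    simpa [hLt] using transpose_mul_eq_neg (A := -A) (by simpa using hA) hAL
  replace hAL : A * L = L := by simpa using hAL
  have hA' : A * Aᵀ = 1 := mul_eq_one_comm.mp hA
  have hKAt : K * Aᵀ = -K := by
    have : K * A * Aᵀ = K := by rw [Matrix.mul_assoc, hA', Matrix.mul_one]
    rw [hKA, Matrix.neg_mul] at this
    exact neg_eq_iff_eq_neg.mp this
  have hLAt : L * Aᵀ = L := by
    have : L * A * Aᵀ = L := by rw [Matrix.mul_assoc, hA', Matrix.mul_one]
    rwa [hLA] at this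
  have hAtK : Aᵀ * K = -K := by
    simpa [hKt, neg_eq_iff_eq_neg] using congrArg Matrix.transpose hKA
  have hAtL : Aᵀ * L = L := by
    simpa [hLt] using congrArg Matrix.transpose hLA
  have hKL : K * L = 0 := by
    have : K * A * L = K * L := by rw [Matrix.mul_assoc, hAL]
    rw [hKA, Matrix.neg_mul] at this
    exact eq_zero_of_neg_eq_self this
  have hLK : L * K = 0 := by
    have : L * A * K = L * K := by rw [hLA]
    rw [Matrix.mul_assoc, hAK, Matrix.mul_neg] at this
    exact eq_zero_of_neg_eq_self this
  refine ⟨A - Aᵀ + K + L, ?_, ?_, fun x hx => ?_⟩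
  · simp only [Matrix.transpose_add, Matrix.transpose_sub, Matrix.transpose_transpose, hKt, hLt]
    abel
  · simp only [mul_add, add_mul, mul_sub, sub_mul, hAK, hKA, hAL, hLA, hA, hA']
  · have hmul (M : Matrix n n ℝ) : (M * (A - Aᵀ + K + L)) *ᵥ x = 0 := by
      rw [← Matrix.mulVec_mulVec, hx, Matrix.mulVec_zero]
    have hKx : K *ᵥ x = 0 := by
      refine mulVec_eq_zero_of_transpose_mul ?_
      have := hmul Kᵀ
      simpa [hKt, mul_add, mul_sub, hKA, hKAt, hKL] using this
    have hLx : L *ᵥ x = 0 := by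
      refine mulVec_eq_zero_of_transpose_mul ?_
      have := hmul Lᵀ
      simpa [hLt, mul_add, mul_sub, hLA, hLAt, hLK] using this
    have hSx : A *ᵥ x = Aᵀ *ᵥ x := by
      rw [Matrix.add_mulVec, Matrix.add_mulVec, hKx, hLx, add_zero, add_zero,
        Matrix.sub_mulVec] at hx
      exact sub_eq_zero.mp hx
    have hAAx : A *ᵥ (A *ᵥ x) = x := by
      rw [hSx, Matrix.mulVec_mulVec, hA', Matrix.one_mulVec]
    have h1 : x - A *ᵥ x = 0 := by
      refine hK _ ?_ ?_
      · rw [Matrix.mulVec_sub, hAAx, neg_sub]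
      · rw [Matrix.mulVec_sub, Matrix.mulVec_mulVec, hKA, Matrix.neg_mulVec, hKx]
        simp
    have h2 : x + A *ᵥ x = 0 := by
      refine hL _ ?_ ?_
      · rw [Matrix.neg_mulVec, Matrix.mulVec_add, hAAx, add_comm]
      · rw [Matrix.mulVec_add, Matrix.mulVec_mulVec, hLA, hLx, add_zero]
    rw [← sub_eq_zero.mp h1] at h2
    exact self_eq_neg.mp (eq_neg_of_add_eq_zero_left h2)

/-- A real combination of the identity and an invertible skew-symmetric matrix is invertible. -/
lemma det_smul_one_sub_smul_skew_ne_zero {S : Matrix n n ℝ} (hS : Sᵀ = -S)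
    (hinj : ∀ x, S *ᵥ x = 0 → x = 0) {a b : ℝ} (hab : a ≠ 0 ∨ b ≠ 0) :
    (a • (1 : Matrix n n ℝ) - b • S).det ≠ 0 := by
  refine det_ne_zero_of_mulVec_eq_zero fun x hx => ?_
  rw [Matrix.sub_mulVec, Matrix.smul_mulVec, Matrix.smul_mulVec, Matrix.one_mulVec] at hx
  by_cases ha : a = 0
  · subst ha
    refine hinj x ?_
    simpa [hab.resolve_left (by simp)] using hx
  · have hskew : x ⬝ᵥ (S *ᵥ x) = 0 := by
      have h : x ⬝ᵥ (S *ᵥ x) = -(x ⬝ᵥ (S *ᵥ x)) := by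
        conv_lhs => rw [Matrix.dotProduct_mulVec, ← Matrix.mulVec_transpose, hS,
          Matrix.neg_mulVec, neg_dotProduct, dotProduct_comm]
      exact self_eq_neg.mp h
    have h := congrArg (x ⬝ᵥ ·) hx
    simp only [dotProduct_sub, dotProduct_smul, hskew, dotProduct_zero, smul_zero, sub_zero] at h
    exact dotProduct_self_eq_zero.mp ((smul_eq_zero.mp h).resolve_left ha)

end SkewCentralizer


/-- Key algebraic fact from Section 7: for `A ∈ SO(2m,ℝ)`, the element `−Id` lies in
the identity component of the centralizer of `A` in `SO(2m,ℝ)`: there is a continuous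
path of special orthogonal matrices commuting with `A` from the identity to `−Id`. -/
theorem neg_one_in_identity_component_of_centralizer
    (m : ℕ) (hm : 1 ≤ m) (A : Matrix (Fin (2 * m)) (Fin (2 * m)) ℝ)
    (horth : Aᵀ * A = 1) (hdet : A.det = 1) :
    ∃ γ : ℝ → Matrix (Fin (2 * m)) (Fin (2 * m)) ℝ,
      ContinuousOn γ (Set.Icc 0 1) ∧ γ 0 = 1 ∧ γ 1 = -1 ∧
      ∀ t ∈ Set.Icc (0:ℝ) 1,
        (γ t)ᵀ * γ t = 1 ∧ (γ t).det = 1 ∧ A * γ t = γ t * A := by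
  obtain ⟨S, hS, hAS, hinj⟩ :=
    exists_invertible_skew_commute (A := A) (by simp) horth hdet
  let N : ℝ → Matrix (Fin (2 * m)) (Fin (2 * m)) ℝ := fun t => (1 - t) • 1 - t • S
  have hNdet (t : ℝ) : (N t).det ≠ 0 := by
    refine det_smul_one_sub_smul_skew_ne_zero hS hinj ?_
    by_contra! h
    linarith [h.1, h.2]
  have hNu (t : ℝ) : IsUnit (N t).det := (hNdet t).isUnit
  have hNt (t : ℝ) : (N t)ᵀ = (1 - t) • 1 + t • S := by
    simp [N, hS]
  have hcomm (t : ℝ) : (N t)ᵀ * N t = N t * (N t)ᵀ := by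
    rw [hNt]
    simp only [N, mul_add, add_mul, mul_sub, sub_mul, smul_mul_smul_comm, one_mul, mul_one]
    module
  have hNc : Continuous N := by fun_prop
  refine ⟨fun t => (N t)ᵀ * (N t)⁻¹, ?_, ?_, ?_, fun t _ => ⟨?_, ?_, ?_⟩⟩
  · refine Continuous.continuousOn (hNc.matrix_transpose.mul ?_)
    simp only [Matrix.inv_def, Ring.inverse_eq_inv']
    exact (hNc.matrix_det.inv₀ hNdet).smul hNc.matrix_adjugate
  · simp [N]
  · have h : (N 1)ᵀ = -N 1 := by simp [N, hS]
    simp only [h, Matrix.neg_mul, Matrix.mul_nonsing_inv _ (hNu 1)]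
  · have hu : IsUnit (N t)ᵀ.det := by rw [Matrix.det_transpose]; exact hNu t
    rw [Matrix.transpose_mul, Matrix.transpose_transpose, Matrix.transpose_nonsing_inv]
    calc ((N t)ᵀ)⁻¹ * N t * ((N t)ᵀ * (N t)⁻¹)
        = ((N t)ᵀ)⁻¹ * (N t * (N t)ᵀ) * (N t)⁻¹ := by simp only [Matrix.mul_assoc]
      _ = (((N t)ᵀ)⁻¹ * (N t)ᵀ) * (N t * (N t)⁻¹) := by
        rw [← hcomm]; simp only [Matrix.mul_assoc]
      _ = 1 := by rw [Matrix.nonsing_inv_mul _ hu, Matrix.mul_nonsing_inv _ (hNu t), mul_one]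
  · rw [Matrix.det_mul, Matrix.det_transpose, Matrix.det_nonsing_inv, Ring.inverse_eq_inv',
      mul_inv_cancel₀ (hNdet t)]
  · have h1 : A * N t = N t * A := by simp [N, mul_sub, sub_mul, hAS]
    have h2 : A * (N t)ᵀ = (N t)ᵀ * A := by simp [hNt, mul_add, add_mul, hAS]
    have h3 : A * (N t)⁻¹ = (N t)⁻¹ * A := by
      calc A * (N t)⁻¹ = (N t)⁻¹ * (N t * A) * (N t)⁻¹ := by
            rw [← Matrix.mul_assoc, Matrix.nonsing_inv_mul _ (hNu t), one_mul]
        _ = (N t)⁻¹ * A * (N t * (N t)⁻¹) := by rw [← h1]; simp only [Matrix.mul_assoc]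
        _ = (N t)⁻¹ * A := by rw [Matrix.mul_nonsing_inv _ (hNu t), mul_one]
    rw [← Matrix.mul_assoc, h2, Matrix.mul_assoc, h3, Matrix.mul_assoc]
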